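/- arXiv:2008.12670 — 2 statements merged into one kernel-verified Lean document; each statement's English description precedes it below -/
import Mathlib

section
/- (Braid relations for the cohomological left Demazure–Lusztig operators.) For every integer i with 1 ≤ i ≤ n−2, T_i^L ∘ T_{i+1}^L ∘ T_i^L = T_{i+1}^L ∘ T_i^L ∘ T_{i+1}^L as operators on M; and for all 1 ≤ i, j ≤ n−1 with |i − j| ≥ 2, T_i^L ∘ T_j^L = T_j^L ∘ T_i^L. -/
open MvPolynomial Finset

noncomputable section

/-- The field `F = ℚ(x_1, …, x_n)`, realized as the fraction field of `ℚ[x_1,…,x_n]`,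
with variables indexed by `Fin n` (so `x_a`, `1 ≤ a ≤ n`, corresponds to index `a-1`). -/
abbrev FF (n : ℕ) : Type := FractionRing (MvPolynomial (Fin n) ℚ)

/-- The action of `S_n` on `F` by `ℚ`-algebra automorphisms permuting the variables,
`w · x_i = x_{w(i)}`. -/
noncomputable def wAct {n : ℕ} (w : Equiv.Perm (Fin n)) : FF n ≃+* FF n :=
  IsFractionRing.ringEquivOfRingEquiv (MvPolynomial.renameEquiv ℚ w).toRingEquiv

/-- The variable `x` (with a `Fin n` index) as an element of `F`. -/
noncomputable def xv {n : ℕ} (i : Fin n) : FF n :=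
  algebraMap (MvPolynomial (Fin n) ℚ) (FF n) (MvPolynomial.X i)

/-- The localization model `M`: functions `S_n → F`, with pointwise operations. -/
abbrev MM (n : ℕ) : Type := Equiv.Perm (Fin n) → FF n

/-- The left Weyl action `(w^L f)(u) = w · (f (w⁻¹ u))`. -/
noncomputable def leftW {n : ℕ} (w : Equiv.Perm (Fin n)) (f : MM n) : MM n :=
  fun u => wAct w (f (w⁻¹ * u))

/-- The right Weyl action `(w^R f)(u) = f (u w)`. -/
noncomputable def rightW {n : ℕ} (w : Equiv.Perm (Fin n)) (f : MM n) : MM n :=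
  fun u => f (u * w)

/-- The simple transposition `s_i = (i, i+1)` (1-based index `i`, `1 ≤ i ≤ n-1`). -/
def sref {n : ℕ} (i : ℕ) (h1 : 1 ≤ i) (h2 : i ≤ n - 1) : Equiv.Perm (Fin n) :=
  Equiv.swap ⟨i - 1, by omega⟩ ⟨i, by omega⟩

/-- The simple root `α_i = x_i - x_{i+1}` (1-based index). -/
noncomputable def alf {n : ℕ} (i : ℕ) (h1 : 1 ≤ i) (h2 : i ≤ n - 1) : FF n :=
  xv ⟨i - 1, by omega⟩ - xv ⟨i, by omega⟩

/-- The fixed-point class `ε_w ∈ M`: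
`ε_w(u) = ∏_{a<b} (x_{w(b)} - x_{w(a)})` if `u = w`, and `0` otherwise. -/
noncomputable def eps {n : ℕ} (w : Equiv.Perm (Fin n)) : MM n := fun u =>
  if u = w then
    ∏ p ∈ Finset.univ.filter (fun p : Fin n × Fin n => p.1 < p.2), (xv (w p.2) - xv (w p.1))
  else 0

/-- The equivariant Euler class `e_w = ∏_{a<b} (x_{w(b)} - x_{w(a)})`. -/
noncomputable def euler {n : ℕ} (w : Equiv.Perm (Fin n)) : FF n :=
  ∏ p ∈ Finset.univ.filter (fun p : Fin n × Fin n => p.1 < p.2), (xv (w p.2) - xv (w p.1))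

/-- The Poincaré pairing `⟨f, g⟩ = Σ_w f(w) g(w) / e_w`. -/
noncomputable def pair {n : ℕ} (f g : MM n) : FF n :=
  ∑ w : Equiv.Perm (Fin n), f w * g w / euler w

/-- The right divided difference (BGG) operator `(∂_i f)(v) = (f(v) - f(v s_i)) / (-(v·α_i))`. -/
noncomputable def rdd {n : ℕ} (i : ℕ) (h1 : 1 ≤ i) (h2 : i ≤ n - 1) (f : MM n) : MM n :=
  fun v => (f v - f (v * sref i h1 h2)) / (-(wAct v (alf i h1 h2)))

/-- The left divided difference operator `(δ_i f)(v) = (f(v) - s_i·(f(s_i v))) / α_i`. -/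
noncomputable def ldd {n : ℕ} (i : ℕ) (h1 : 1 ≤ i) (h2 : i ≤ n - 1) (f : MM n) : MM n :=
  fun v => (f v - wAct (sref i h1 h2) (f (sref i h1 h2 * v))) / alf i h1 h2

/-- The left Demazure–Lusztig operator `T_i^L = -δ_i + s_i^L`. -/
noncomputable def tL {n : ℕ} (i : ℕ) (h1 : 1 ≤ i) (h2 : i ≤ n - 1) (f : MM n) : MM n :=
  -(ldd i h1 h2 f) + leftW (sref i h1 h2) f

/-- The dual left Demazure–Lusztig operator `T_i^{L,∨} = δ_i + s_i^L`. -/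
noncomputable def tLd {n : ℕ} (i : ℕ) (h1 : 1 ≤ i) (h2 : i ≤ n - 1) (f : MM n) : MM n :=
  ldd i h1 h2 f + leftW (sref i h1 h2) f

/-- The right Demazure–Lusztig operator `T_i^R = ∂_i - s_i^R`. -/
noncomputable def tR {n : ℕ} (i : ℕ) (h1 : 1 ≤ i) (h2 : i ≤ n - 1) (f : MM n) : MM n :=
  rdd i h1 h2 f - rightW (sref i h1 h2) f

theorem wAct_xv {n : ℕ} (w : Equiv.Perm (Fin n)) (i : Fin n) : wAct w (xv i) = xv (w i) := by
  simp only [wAct, xv]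
  rw [IsFractionRing.ringEquivOfRingEquiv_algebraMap]
  simp

theorem wAct_mul_apply {n : ℕ} (u w : Equiv.Perm (Fin n)) (z : FF n) :
    wAct u (wAct w z) = wAct (u * w) z := by
  obtain ⟨p, q, -, rfl⟩ := IsFractionRing.div_surjective (A := MvPolynomial (Fin n) ℚ) z
  simp only [wAct, map_div₀]
  repeat rw [IsFractionRing.ringEquivOfRingEquiv_algebraMap]
  simp [MvPolynomial.rename_rename, Equiv.Perm.coe_mul]

theorem wAct_one_apply {n : ℕ} (z : FF n) : wAct 1 z = z := by
  apply (wAct (1 : Equiv.Perm (Fin n))).injective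
  rw [wAct_mul_apply, one_mul]

theorem xv_sub_ne_zero {n : ℕ} {a b : Fin n} (h : a ≠ b) : xv a - xv b ≠ 0 := by
  rw [sub_ne_zero]
  intro e
  exact h (MvPolynomial.X_injective (IsFractionRing.injective (MvPolynomial (Fin n) ℚ) (FF n) e))

/-- The left Demazure–Lusztig operator of an arbitrary transposition `(a, b)`. -/
def swapDL {n : ℕ} (a b : Fin n) (f : MM n) : MM n := fun v =>
  -((f v - wAct (Equiv.swap a b) (f (Equiv.swap a b * v))) / (xv a - xv b)) +
    wAct (Equiv.swap a b) (f (Equiv.swap a b * v))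

theorem tL_eq_swapDL {n : ℕ} (i : ℕ) (h1 : 1 ≤ i) (h2 : i ≤ n - 1) (f : MM n) :
    tL i h1 h2 f = swapDL ⟨i - 1, by omega⟩ ⟨i, by omega⟩ f := by
  funext v
  simp [tL, ldd, leftW, swapDL, sref, alf]

theorem swapDL_comm {n : ℕ} {a b c d : Fin n} (hab : a ≠ b) (hcd : c ≠ d) (hac : a ≠ c)
    (had : a ≠ d) (hbc : b ≠ c) (hbd : b ≠ d) (f : MM n) :
    swapDL a b (swapDL c d f) = swapDL c d (swapDL a b f) := by
  funext v
  have hs : Equiv.swap c d * Equiv.swap a b = Equiv.swap a b * Equiv.swap c d := by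
    ext x
    simp only [Equiv.Perm.mul_apply, Equiv.swap_apply_def]
    split_ifs <;> simp_all
  have h1 := xv_sub_ne_zero hab
  have h2 := xv_sub_ne_zero hcd
  simp only [swapDL, map_add, map_neg, map_sub, map_div₀, wAct_xv, wAct_mul_apply, ← mul_assoc, hs,
    Equiv.swap_apply_of_ne_of_ne hac.symm hbc.symm, Equiv.swap_apply_of_ne_of_ne had.symm hbd.symm,
    Equiv.swap_apply_of_ne_of_ne hac had, Equiv.swap_apply_of_ne_of_ne hbc hbd]
  field_simp
  ring

theorem swapDL_braid {n : ℕ} {a b c : Fin n} (hab : a ≠ b) (hbc : b ≠ c) (hac : a ≠ c)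
    (f : MM n) :
    swapDL a b (swapDL b c (swapDL a b f)) = swapDL b c (swapDL a b (swapDL b c f)) := by
  funext v
  have hs : Equiv.swap b c * Equiv.swap a b * Equiv.swap b c =
      Equiv.swap a b * Equiv.swap b c * Equiv.swap a b := by
    ext x
    simp only [Equiv.Perm.mul_apply, Equiv.swap_apply_def]
    split_ifs <;> simp_all
  have h1 := xv_sub_ne_zero hab
  have h2 := xv_sub_ne_zero hbc
  have h3 := xv_sub_ne_zero hac
  simp only [swapDL, map_add, map_neg, map_sub, map_div₀, wAct_xv, wAct_mul_apply, ← mul_assoc, hs,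
    Equiv.swap_mul_self, one_mul, wAct_one_apply,
    Equiv.swap_apply_left, Equiv.swap_apply_right,
    Equiv.swap_apply_of_ne_of_ne hac.symm hbc.symm, Equiv.swap_apply_of_ne_of_ne hab hac]
  generalize wAct (Equiv.swap a b * Equiv.swap b c * Equiv.swap a b) _ = y₁
  generalize wAct (Equiv.swap a b * Equiv.swap b c) _ = y₂
  generalize wAct (Equiv.swap b c * Equiv.swap a b) _ = y₃
  generalize wAct (Equiv.swap a b) _ = y₄
  generalize wAct (Equiv.swap b c) _ = y₅
  generalize f v = y₆
  generalize xv a = x at *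
  generalize xv b = y at *
  generalize xv c = z at *
  rw [← neg_sub x y, ← neg_sub y z]
  field_simp
  ring

/-- Braid relations for the cohomological left Demazure–Lusztig operators:
`T_i^L T_{i+1}^L T_i^L = T_{i+1}^L T_i^L T_{i+1}^L` for `1 ≤ i ≤ n-2`, and
`T_i^L T_j^L = T_j^L T_i^L` for `|i - j| ≥ 2`. -/
theorem left_DL_braid_relations (n : ℕ) (hn : 2 ≤ n) :
    (∀ (i : ℕ) (h1 : 1 ≤ i) (h2 : i ≤ n - 2) (f : MM n),
      tL i h1 (by omega) (tL (i + 1) (by omega) (by omega) (tL i h1 (by omega) f))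
        = tL (i + 1) (by omega) (by omega) (tL i h1 (by omega)
            (tL (i + 1) (by omega) (by omega) f))) ∧
    (∀ (i j : ℕ) (hi1 : 1 ≤ i) (hi2 : i ≤ n - 1) (hj1 : 1 ≤ j) (hj2 : j ≤ n - 1),
      (i + 2 ≤ j ∨ j + 2 ≤ i) → ∀ f : MM n,
      tL i hi1 hi2 (tL j hj1 hj2 f) = tL j hj1 hj2 (tL i hi1 hi2 f)) := by
  refine ⟨fun i h1 h2 f => ?_, fun i j hi1 hi2 hj1 hj2 hij f => ?_⟩
  · simp only [tL_eq_swapDL, Nat.add_sub_cancel]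
    apply swapDL_braid <;> simp only [ne_eq, Fin.mk.injEq] <;> omega
  · simp only [tL_eq_swapDL]
    apply swapDL_comm <;> simp only [ne_eq, Fin.mk.injEq] <;> omega
end
end

section
/- (Braid relations for the K-theoretic left Demazure–Lusztig operators.) For every integer i with 1 ≤ i ≤ n−2, T_i^L ∘ T_{i+1}^L ∘ T_i^L = T_{i+1}^L ∘ T_i^L ∘ T_{i+1}^L as operators on M; and for all 1 ≤ i, j ≤ n−1 with |i − j| ≥ 2, T_i^L ∘ T_j^L = T_j^L ∘ T_i^L. -/
open MvPolynomial Finset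

noncomputable section

/-- The field `K = ℚ(y, z_1, …, z_n)`, realized as the fraction field of the polynomial ring
in variables indexed by `Option (Fin n)`: `none ↦ y` and `some i ↦ z_i`. -/
abbrev KK (n : ℕ) : Type := FractionRing (MvPolynomial (Option (Fin n)) ℚ)

/-- The action of `S_n` on `K` by `ℚ`-algebra automorphisms permuting the `z`-variables
(`w · z_i = z_{w(i)}`) and fixing `y`. -/
noncomputable def wActK {n : ℕ} (w : Equiv.Perm (Fin n)) : KK n ≃+* KK n :=
  IsFractionRing.ringEquivOfRingEquiv
    (MvPolynomial.renameEquiv ℚ (Equiv.optionCongr w)).toRingEquiv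

/-- The variable `z` (with a `Fin n` index) as an element of `K`. -/
noncomputable def zv {n : ℕ} (i : Fin n) : KK n :=
  algebraMap (MvPolynomial (Option (Fin n)) ℚ) (KK n) (MvPolynomial.X (some i))

/-- The variable `y` as an element of `K`. -/
noncomputable def yv {n : ℕ} : KK n :=
  algebraMap (MvPolynomial (Option (Fin n)) ℚ) (KK n) (MvPolynomial.X none)

/-- The localization model `M`: functions `S_n → K`, with pointwise operations. -/
abbrev MK (n : ℕ) : Type := Equiv.Perm (Fin n) → KK n

/-- The left Weyl action `(w^L f)(u) = w · (f (w⁻¹ u))`. -/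
noncomputable def leftWK {n : ℕ} (w : Equiv.Perm (Fin n)) (f : MK n) : MK n :=
  fun u => wActK w (f (w⁻¹ * u))

/-- The right Weyl action `(w^R f)(u) = f (u w)`. -/
noncomputable def rightWK {n : ℕ} (w : Equiv.Perm (Fin n)) (f : MK n) : MK n :=
  fun u => f (u * w)

/-- The simple transposition `s_i = (i, i+1)` (1-based index `i`, `1 ≤ i ≤ n-1`). -/
def srefK {n : ℕ} (i : ℕ) (h1 : 1 ≤ i) (h2 : i ≤ n - 1) : Equiv.Perm (Fin n) :=
  Equiv.swap ⟨i - 1, by omega⟩ ⟨i, by omega⟩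

/-- `e^{α_i} = z_i / z_{i+1}` (1-based index). -/
noncomputable def ealf {n : ℕ} (i : ℕ) (h1 : 1 ≤ i) (h2 : i ≤ n - 1) : KK n :=
  zv ⟨i - 1, by omega⟩ / zv ⟨i, by omega⟩

/-- `e^{-α_i} = z_{i+1} / z_i` (1-based index). -/
noncomputable def ealfInv {n : ℕ} (i : ℕ) (h1 : 1 ≤ i) (h2 : i ≤ n - 1) : KK n :=
  zv ⟨i, by omega⟩ / zv ⟨i - 1, by omega⟩

/-- The K-theoretic left Demazure operator
`(δ_i f)(v) = (f(v) - e^{α_i}·s_i·(f(s_i v))) / (1 - e^{α_i})`. -/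
noncomputable def lddK {n : ℕ} (i : ℕ) (h1 : 1 ≤ i) (h2 : i ≤ n - 1) (f : MK n) : MK n :=
  fun v => (f v - ealf i h1 h2 * wActK (srefK i h1 h2) (f (srefK i h1 h2 * v)))
    / (1 - ealf i h1 h2)

/-- The dual K-theoretic left Demazure operator
`(δ_i^∨ f)(v) = (f(v) - e^{-α_i}·s_i·(f(s_i v))) / (1 - e^{-α_i})`. -/
noncomputable def lddKd {n : ℕ} (i : ℕ) (h1 : 1 ≤ i) (h2 : i ≤ n - 1) (f : MK n) : MK n :=
  fun v => (f v - ealfInv i h1 h2 * wActK (srefK i h1 h2) (f (srefK i h1 h2 * v)))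
    / (1 - ealfInv i h1 h2)

/-- The K-theoretic right Demazure operator
`(∂_i f)(v) = (f(v) - e^{v·α_i}·f(v s_i)) / (1 - e^{v·α_i})`. -/
noncomputable def rddK {n : ℕ} (i : ℕ) (h1 : 1 ≤ i) (h2 : i ≤ n - 1) (f : MK n) : MK n :=
  fun v => (f v - wActK v (ealf i h1 h2) * f (v * srefK i h1 h2))
    / (1 - wActK v (ealf i h1 h2))

/-- The K-theoretic fixed-point class `ι_w ∈ M`:
`ι_w(u) = ∏_{a<b} (1 - z_{w(a)}/z_{w(b)})` if `u = w`, and `0` otherwise. -/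
noncomputable def iot {n : ℕ} (w : Equiv.Perm (Fin n)) : MK n := fun u =>
  if u = w then
    ∏ p ∈ Finset.univ.filter (fun p : Fin n × Fin n => p.1 < p.2), (1 - zv (w p.1) / zv (w p.2))
  else 0

/-- The K-theoretic left Demazure–Lusztig operator
`(T_i^L f)(v) = ((1 + y e^{-α_i}) · s_i·(f(s_i v)) - (1 + y) f(v)) / (1 - e^{-α_i})`. -/
noncomputable def tKL {n : ℕ} (i : ℕ) (h1 : 1 ≤ i) (h2 : i ≤ n - 1) (f : MK n) : MK n :=
  fun v => ((1 + yv * ealfInv i h1 h2) * wActK (srefK i h1 h2) (f (srefK i h1 h2 * v))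
    - (1 + yv) * f v) / (1 - ealfInv i h1 h2)

/-- The dual K-theoretic left Demazure–Lusztig operator
`(T_i^{L,∨} f)(v) = ((1 + y e^{α_i}) · s_i·(f(s_i v)) - (1 + y) f(v)) / (1 - e^{α_i})`. -/
noncomputable def tKLd {n : ℕ} (i : ℕ) (h1 : 1 ≤ i) (h2 : i ≤ n - 1) (f : MK n) : MK n :=
  fun v => ((1 + yv * ealf i h1 h2) * wActK (srefK i h1 h2) (f (srefK i h1 h2 * v))
    - (1 + yv) * f v) / (1 - ealf i h1 h2)

/-- Pointwise multiplication of an element of `M` by a constant `c ∈ K`. -/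
noncomputable def emul {n : ℕ} (c : KK n) (f : MK n) : MK n := fun v => c * f v

lemma wActK_algebraMap {n : ℕ} (w : Equiv.Perm (Fin n)) (p : MvPolynomial (Option (Fin n)) ℚ) :
    wActK w (algebraMap _ (KK n) p)
      = algebraMap _ (KK n) (MvPolynomial.rename (Equiv.optionCongr w) p) := by
  simp [wActK]

lemma wActK_zv {n : ℕ} (w : Equiv.Perm (Fin n)) (i : Fin n) :
    wActK w (zv i) = zv (w i) := by
  simp [zv, wActK_algebraMap]

lemma wActK_yv {n : ℕ} (w : Equiv.Perm (Fin n)) : wActK w (yv : KK n) = yv := by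
  simp [yv, wActK_algebraMap]

lemma wActK_wActK {n : ℕ} (w u : Equiv.Perm (Fin n)) (x : KK n) :
    wActK w (wActK u x) = wActK (w * u) x := by
  obtain ⟨p, q, -, rfl⟩ := IsFractionRing.div_surjective (A := MvPolynomial (Option (Fin n)) ℚ) x
  simp only [map_div₀, wActK_algebraMap, MvPolynomial.rename_rename]
  have h : (Equiv.optionCongr w ∘ Equiv.optionCongr u : Option (Fin n) → Option (Fin n))
      = Equiv.optionCongr (w * u) := by
    ext1 a
    cases a <;> simp
  rw [h]

lemma wActK_one {n : ℕ} (x : KK n) : wActK 1 x = x := by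
  apply (wActK (1 : Equiv.Perm (Fin n))).injective
  rw [wActK_wActK, one_mul]

lemma zv_injective {n : ℕ} : Function.Injective (zv : Fin n → KK n) := fun i j h => by
  have := MvPolynomial.X_injective (IsFractionRing.injective _ _ h)
  simpa using this

lemma zv_ne_zero {n : ℕ} (i : Fin n) : (zv i : KK n) ≠ 0 := fun h =>
  MvPolynomial.X_ne_zero (R := ℚ) (some i)
    (IsFractionRing.injective _ (KK n) (h.trans (map_zero _).symm))

/-- The left Demazure–Lusztig operator attached to a reflection `(p q)`, not necessarily simple. -/
def leftDL {n : ℕ} (p q : Fin n) (f : MK n) : MK n := fun v =>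
  ((1 + yv * (zv q / zv p)) * wActK (Equiv.swap p q) (f (Equiv.swap p q * v))
    - (1 + yv) * f v) / (1 - zv q / zv p)

lemma one_sub_zv_div_ne_zero {n : ℕ} {p q : Fin n} (h : p ≠ q) :
    (1 - zv q / zv p : KK n) ≠ 0 := by
  rw [sub_ne_zero, ne_comm, Ne, div_eq_one_iff_eq (zv_ne_zero p)]
  exact fun e => h (zv_injective e).symm

lemma leftDL_braid {n : ℕ} {a b c : Fin n} (hab : a ≠ b) (hac : a ≠ c) (hbc : b ≠ c) (f : MK n) :
    leftDL a b (leftDL b c (leftDL a b f)) = leftDL b c (leftDL a b (leftDL b c f)) := by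
  funext v
  have hs : Equiv.swap b c * Equiv.swap a b * Equiv.swap b c
      = Equiv.swap a b * Equiv.swap b c * Equiv.swap a b := by
    rw [Equiv.swap_mul_swap_mul_swap hab hac, Equiv.swap_comm a b, Equiv.swap_comm b c,
      Equiv.swap_mul_swap_mul_swap hbc.symm hac.symm, Equiv.swap_comm]
  have e1 : Equiv.swap a b c = c := Equiv.swap_apply_of_ne_of_ne hac.symm hbc.symm
  have e2 : Equiv.swap b c a = a := Equiv.swap_apply_of_ne_of_ne hab hac
  simp only [leftDL, map_div₀, map_sub, map_mul, map_add, map_one, wActK_zv, wActK_yv,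
    wActK_wActK, ← mul_assoc, Equiv.swap_apply_left, Equiv.swap_apply_right, e1, e2, hs,
    Equiv.swap_mul_self, one_mul, wActK_one]
  have hA := zv_ne_zero a
  have hB := zv_ne_zero b
  have hC := zv_ne_zero c
  have hAB : (zv a - zv b : KK n) ≠ 0 := sub_ne_zero.2 (zv_injective.ne hab)
  have hAC : (zv a - zv c : KK n) ≠ 0 := sub_ne_zero.2 (zv_injective.ne hac)
  have hBC : (zv b - zv c : KK n) ≠ 0 := sub_ne_zero.2 (zv_injective.ne hbc)
  have hBA : (zv b - zv a : KK n) ≠ 0 := sub_ne_zero.2 (zv_injective.ne hab.symm)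
  have hCB : (zv c - zv b : KK n) ≠ 0 := sub_ne_zero.2 (zv_injective.ne hbc.symm)
  generalize (zv a : KK n) = A at *
  generalize (zv b : KK n) = B at *
  generalize (zv c : KK n) = C at *
  generalize (yv : KK n) = y at *
  field_simp
  ring

lemma leftDL_comm {n : ℕ} {a b c d : Fin n} (hab : a ≠ b) (hcd : c ≠ d) (hac : a ≠ c)
    (had : a ≠ d) (hbc : b ≠ c) (hbd : b ≠ d) (f : MK n) :
    leftDL a b (leftDL c d f) = leftDL c d (leftDL a b f) := by
  funext v
  have hs : Equiv.swap c d * Equiv.swap a b = Equiv.swap a b * Equiv.swap c d :=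
    (Equiv.Perm.disjoint_swap_swap (by simp [*, Ne.symm])).commute.eq
  have e1 : Equiv.swap a b c = c := Equiv.swap_apply_of_ne_of_ne hac.symm hbc.symm
  have e2 : Equiv.swap a b d = d := Equiv.swap_apply_of_ne_of_ne had.symm hbd.symm
  have e3 : Equiv.swap c d a = a := Equiv.swap_apply_of_ne_of_ne hac had
  have e4 : Equiv.swap c d b = b := Equiv.swap_apply_of_ne_of_ne hbc hbd
  simp only [leftDL, map_div₀, map_sub, map_mul, map_add, map_one, wActK_zv, wActK_yv,
    wActK_wActK, ← mul_assoc, e1, e2, e3, e4, hs]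
  have hA := one_sub_zv_div_ne_zero hab
  have hC := one_sub_zv_div_ne_zero hcd
  generalize (zv b / zv a : KK n) = A at *
  generalize (zv d / zv c : KK n) = C at *
  field_simp
  ring

lemma tKL_eq_leftDL {n : ℕ} (i : ℕ) (h1 : 1 ≤ i) (h2 : i ≤ n - 1) :
    (tKL i h1 h2 : MK n → MK n) = leftDL ⟨i - 1, by omega⟩ ⟨i, by omega⟩ := rfl

/-- Braid relations for the K-theoretic left Demazure–Lusztig operators:
`T_i^L T_{i+1}^L T_i^L = T_{i+1}^L T_i^L T_{i+1}^L` for `1 ≤ i ≤ n-2`, and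
`T_i^L T_j^L = T_j^L T_i^L` for `|i - j| ≥ 2`. -/
theorem K_left_DL_braid_relations (n : ℕ) (hn : 2 ≤ n) :
    (∀ (i : ℕ) (h1 : 1 ≤ i) (h2 : i ≤ n - 2) (f : MK n),
      tKL i h1 (by omega) (tKL (i + 1) (by omega) (by omega) (tKL i h1 (by omega) f))
        = tKL (i + 1) (by omega) (by omega) (tKL i h1 (by omega)
            (tKL (i + 1) (by omega) (by omega) f))) ∧
    (∀ (i j : ℕ) (hi1 : 1 ≤ i) (hi2 : i ≤ n - 1) (hj1 : 1 ≤ j) (hj2 : j ≤ n - 1),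
      (i + 2 ≤ j ∨ j + 2 ≤ i) → ∀ f : MK n,
      tKL i hi1 hi2 (tKL j hj1 hj2 f) = tKL j hj1 hj2 (tKL i hi1 hi2 f)) := by
  constructor
  · intro i h1 h2 f
    simp only [tKL_eq_leftDL, Nat.add_sub_cancel]
    apply leftDL_braid <;> simp only [ne_eq, Fin.mk.injEq] <;> omega
  · intro i j hi1 hi2 hj1 hj2 hij f
    simp only [tKL_eq_leftDL]
    apply leftDL_comm <;> simp only [ne_eq, Fin.mk.injEq] <;> omega
end
end
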